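/- arXiv:2310.01322 — 7 statements merged into one kernel-verified Lean document; each statement's English description precedes it below -/
import Mathlib

section
/- Let H be a finite set, let σ1 be a fixed-point-free involution of H (so |H| = 2e is even, and the orbits of σ1 are the e edges), and let σ0 be an arbitrary permutation of H. Write v for the number of orbits of σ0 on H and n for the number of orbits of the permutation σ∞ := σ0⁻¹σ1 on H. Then v − e + n is even; equivalently, the number g defined by v − e + n = 2 − 2g is an integer. -/
/-- The number of orbits of a permutation `σ` on `H`
(orbits are classes of the `SameCycle` equivalence relation). -/
noncomputable def numOrbits {H : Type*} [Fintype H] (σ : Equiv.Perm H) : ℕ :=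
  Nat.card (Quotient (⟨σ.SameCycle,
    ⟨fun x => Equiv.Perm.SameCycle.refl σ x,
     fun h => h.symm, fun h h' => h.trans h'⟩⟩ : Setoid H))

/-- A permutation has one orbit for each of its nontrivial cycles and one for each fixed point. -/
theorem numOrbits_eq_card_cycleType_add_card_compl_support {H : Type*} [Fintype H]
    [DecidableEq H] (σ : Equiv.Perm H) :
    numOrbits σ = Multiset.card σ.cycleType + σ.supportᶜ.card := by
  let f : H → Equiv.Perm H ⊕ H := fun x => if σ x = x then Sum.inr x else Sum.inl (σ.cycleOf x)
  have hker : ∀ x y, σ.SameCycle x y ↔ f x = f y := by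
    intro x y
    by_cases hx : σ x = x <;> by_cases hy : σ y = y
    · simp only [f, hx, hy, if_true, Sum.inr.injEq]
      exact ⟨fun h => h.eq_of_left hx, fun h => h ▸ Equiv.Perm.SameCycle.refl σ x⟩
    · simp only [f, hx, hy, if_true, if_false, reduceCtorEq, iff_false]
      exact fun h => hy (h.apply_eq_self_iff.mp hx)
    · simp only [f, hx, hy, if_true, if_false, reduceCtorEq, iff_false]
      exact fun h => hx (h.apply_eq_self_iff.mpr hy)
    · simp only [f, hx, hy, if_false, Sum.inl.injEq]
      exact Equiv.Perm.sameCycle_iff_cycleOf_eq_of_mem_support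
        (Equiv.Perm.mem_support.mpr hx) (Equiv.Perm.mem_support.mpr hy)
  have hrange : Set.range f = (σ.cycleFactorsFinset.disjSum σ.supportᶜ : Finset _) := by
    ext z
    rw [Finset.mem_coe, Finset.mem_disjSum]
    constructor
    · rintro ⟨x, rfl⟩
      by_cases hx : σ x = x
      · exact Or.inr ⟨x, by simpa using hx, by simp [f, hx]⟩
      · exact Or.inl ⟨σ.cycleOf x, Equiv.Perm.cycleOf_mem_cycleFactorsFinset_iff.mpr
          (Equiv.Perm.mem_support.mpr hx), by simp [f, hx]⟩
    · rintro (⟨c, hc, rfl⟩ | ⟨x, hx, rfl⟩)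
      · obtain ⟨x, hx⟩ := (Equiv.Perm.mem_cycleFactorsFinset_iff.mp hc).1.nonempty_support
        have hσx : σ x ≠ x := Equiv.Perm.mem_support.mp
          (Equiv.Perm.mem_cycleFactorsFinset_support_le hc hx)
        exact ⟨x, by simp [f, hσx, ← Equiv.Perm.cycle_is_cycleOf hx hc]⟩
      · have hσx : σ x = x := by simpa using hx
        exact ⟨x, by simp [f, hσx]⟩
  have hset : (⟨σ.SameCycle,
      ⟨fun x => Equiv.Perm.SameCycle.refl σ x,
       fun h => h.symm, fun h h' => h.trans h'⟩⟩ : Setoid H) = Setoid.ker f :=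
    Setoid.ext hker
  rw [numOrbits, hset, Nat.card_congr (Setoid.quotientKerEquivRange f), hrange,
    Nat.card_coe_set_eq, Set.ncard_coe_finset, Finset.card_disjSum, Equiv.Perm.cycleType_def,
    Multiset.card_map, Finset.card_val]

/-- The sign of a permutation in terms of its number of orbits. -/
theorem sign_eq_neg_one_pow_card_add_numOrbits {H : Type*} [Fintype H] [DecidableEq H]
    (σ : Equiv.Perm H) :
    Equiv.Perm.sign σ = (-1 : ℤˣ) ^ (Fintype.card H + numOrbits σ) := by
  have hcard : σ.support.card + σ.supportᶜ.card = Fintype.card H :=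
    Finset.card_add_card_compl _
  rw [Equiv.Perm.sign_of_cycleType, Equiv.Perm.sum_cycleType,
    numOrbits_eq_card_cycleType_add_card_compl_support, ← hcard,
    show σ.support.card + σ.supportᶜ.card + (Multiset.card σ.cycleType + σ.supportᶜ.card) =
      σ.support.card + Multiset.card σ.cycleType + 2 * σ.supportᶜ.card by ring,
    pow_add _ _ (2 * _), pow_mul]
  simp

/-- A finite type with a fixed-point-free involution has even cardinality. -/
theorem even_card_of_involution_of_forall_ne {H : Type*} [Fintype H] (σ : Equiv.Perm H)
    (hinv : σ * σ = 1) (hfpf : ∀ h : H, σ h ≠ h) : Even (Fintype.card H) := by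
  classical
  have hsupp : σ.support = Finset.univ := by
    ext x
    simpa using hfpf x
  rw [even_iff_two_dvd, ← Finset.card_univ, ← hsupp]
  exact Equiv.Perm.two_dvd_card_support (by rw [sq, hinv])

/-- For a ribbon graph encoded by a fixed-point-free involution `σ1` and an arbitrary
permutation `σ0` of a finite set `H` of half-edges, with `v` vertices (orbits of `σ0`),
`e` edges (orbits of `σ1`) and `n` boundary cycles (orbits of `σ∞ = σ0⁻¹σ1`),
the number `v - e + n` is even; i.e. the genus `g` with `v - e + n = 2 - 2g` is an integer. -/
theorem stmt_0 {H : Type*} [Fintype H] (σ0 σ1 : Equiv.Perm H)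
    (hinv : σ1 * σ1 = 1) (hfpf : ∀ h : H, σ1 h ≠ h) :
    ∃ g : ℤ, (numOrbits σ0 : ℤ) - numOrbits σ1 + numOrbits (σ0⁻¹ * σ1) = 2 - 2 * g := by
  classical
  obtain ⟨k, hk⟩ := even_card_of_involution_of_forall_ne σ1 hinv hfpf
  have hsign : Equiv.Perm.sign (σ0⁻¹ * σ1) = Equiv.Perm.sign σ0 * Equiv.Perm.sign σ1 := by
    rw [Equiv.Perm.sign_mul, Equiv.Perm.sign_inv]
  simp only [sign_eq_neg_one_pow_card_add_numOrbits, ← pow_add] at hsign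
  have hparity := congrArg (· = (1 : ℤˣ)) hsign
  simp only [neg_one_pow_eq_one_iff_even (show (-1 : ℤˣ) ≠ 1 by decide), Nat.even_iff,
    eq_iff_iff] at hparity
  exact ⟨(2 - ((numOrbits σ0 : ℤ) - numOrbits σ1 + numOrbits (σ0⁻¹ * σ1))) / 2, by omega⟩
end

section
/- Let H be a finite set, let σ1 be a fixed-point-free involution of H with e = |H|/2 edges, and let σ0 be a permutation of H such that the subgroup of the symmetric group of H generated by σ0 and σ1 acts transitively on H (i.e., the ribbon graph is connected). Write v for the number of orbits of σ0 and n for the number of orbits of σ∞ := σ0⁻¹σ1. Then v − e + n ≤ 2; equivalently, the genus g defined by v − e + n = 2 − 2g satisfies g ≥ 0. -/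
section RibbonGenus

variable {H : Type*}

/-- The linear endomorphism `f ↦ f - f ∘ σ⁻¹` of the space of rational functions on `H`. -/
def permDiff (σ : Equiv.Perm H) : (H → ℚ) →ₗ[ℚ] (H → ℚ) :=
  LinearMap.id - LinearMap.funLeft ℚ ℚ σ.symm

theorem permDiff_apply (σ : Equiv.Perm H) (f : H → ℚ) (h : H) :
    permDiff σ f h = f h - f (σ.symm h) := rfl

theorem mem_ker_permDiff {σ : Equiv.Perm H} {f : H → ℚ} :
    f ∈ LinearMap.ker (permDiff σ) ↔ ∀ h, f (σ h) = f h := by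
  rw [LinearMap.mem_ker, funext_iff]
  constructor
  · intro hf h
    have := hf (σ h)
    rw [permDiff_apply, Equiv.symm_apply_apply] at this
    exact sub_eq_zero.mp this
  · intro hf h
    have := hf (σ.symm h)
    rw [Equiv.apply_symm_apply] at this
    rw [permDiff_apply, this, sub_self, Pi.zero_apply]

theorem permDiff_single [DecidableEq H] (σ : Equiv.Perm H) (x : H) :
    permDiff σ (Pi.single x 1) = Pi.single x 1 - Pi.single (σ x) 1 := by
  ext h
  simp only [permDiff_apply, Pi.sub_apply, Pi.single_apply, Equiv.symm_apply_eq]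

/-- A function invariant under `σ` is constant on the cycles of `σ`. -/
theorem eq_of_sameCycle {σ : Equiv.Perm H} {f : H → ℚ} (hf : ∀ h, f (σ h) = f h) {x y : H}
    (hxy : σ.SameCycle x y) : f x = f y := by
  obtain ⟨i, rfl⟩ := hxy
  induction i using Int.induction_on generalizing x with
  | zero => rfl
  | succ n ih =>
    rw [zpow_add_one, Equiv.Perm.mul_apply, ← ih, hf]
  | pred n ih =>
    rw [zpow_sub_one, Equiv.Perm.mul_apply, ← ih, Equiv.Perm.inv_def, ← hf (σ.symm x),
      Equiv.apply_symm_apply]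

/-- The functions invariant under `σ` form a space whose dimension is the number of orbits. -/
theorem finrank_ker_permDiff [Fintype H] (σ : Equiv.Perm H) :
    Module.finrank ℚ (LinearMap.ker (permDiff σ)) = numOrbits σ := by
  classical
  unfold numOrbits
  set s : Setoid H := ⟨σ.SameCycle, _⟩
  have : Fintype (Quotient s) := Fintype.ofFinite _
  have hrange : LinearMap.range (LinearMap.funLeft ℚ ℚ (Quotient.mk s)) =
      LinearMap.ker (permDiff σ) := by
    ext f
    rw [mem_ker_permDiff]
    constructor
    · rintro ⟨g, rfl⟩ h
      exact congrArg g (Quotient.sound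
        (Equiv.Perm.sameCycle_apply_left.mpr (Equiv.Perm.SameCycle.refl σ h)))
    · intro hf
      exact ⟨Quotient.lift f fun x y hxy => eq_of_sameCycle hf hxy, rfl⟩
  rw [← hrange, LinearMap.finrank_range_of_inj
    (LinearMap.funLeft_injective_of_surjective ℚ ℚ _ Quotient.mk_surjective),
    Module.finrank_fintype_fun_eq_card, Nat.card_eq_fintype_card]

theorem finrank_range_permDiff [Fintype H] (σ : Equiv.Perm H) :
    Module.finrank ℚ (LinearMap.range (permDiff σ)) + numOrbits σ = Fintype.card H := by
  rw [← finrank_ker_permDiff, LinearMap.finrank_range_add_finrank_ker,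
    Module.finrank_fintype_fun_eq_card]

/-- If `σ` and `τ` generate a transitive group, the ranges of `permDiff σ` and `permDiff τ`
together span a subspace of codimension at most one. -/
theorem card_le_finrank_range_sup [Fintype H] {σ τ : Equiv.Perm H} (x₀ : H)
    (htrans : ∀ y : H, ∃ p ∈ Subgroup.closure ({σ, τ} : Set (Equiv.Perm H)), p x₀ = y) :
    Fintype.card H ≤ Module.finrank ℚ
      (LinearMap.range (permDiff σ) ⊔ LinearMap.range (permDiff τ) : Submodule ℚ (H → ℚ)) + 1 := by
  classical
  set S := LinearMap.range (permDiff σ) ⊔ LinearMap.range (permDiff τ)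
  have hmem : ∀ p ∈ Subgroup.closure ({σ, τ} : Set (Equiv.Perm H)),
      ∀ x, (Pi.single x 1 - Pi.single (p x) 1 : H → ℚ) ∈ S := by
    intro p hp
    induction hp using Subgroup.closure_induction with
    | mem p hp =>
      intro x
      rw [← permDiff_single]
      rcases hp with rfl | rfl
      · exact Submodule.mem_sup_left ⟨_, rfl⟩
      · exact Submodule.mem_sup_right ⟨_, rfl⟩
    | one => intro x; simp
    | mul p q _ _ hp hq =>
      intro x
      simpa using S.add_mem (hq x) (hp (q x))
    | inv p _ hp =>
      intro x
      simpa using S.neg_mem (hp (p.symm x))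
  have htop : S ⊔ Submodule.span ℚ {(Pi.single x₀ 1 : H → ℚ)} = ⊤ := by
    rw [eq_top_iff, ← (Pi.basisFun ℚ H).span_eq, Submodule.span_le]
    rintro _ ⟨y, rfl⟩
    obtain ⟨p, hp, rfl⟩ := htrans y
    rw [Pi.basisFun_apply, SetLike.mem_coe, ← sub_sub_cancel (Pi.single x₀ 1) (Pi.single (p x₀) 1)]
    exact Submodule.sub_mem _
      (Submodule.mem_sup_right (Submodule.mem_span_singleton_self _))
      (Submodule.mem_sup_left (hmem p hp x₀))
  calc Fintype.card H = Module.finrank ℚ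
        (S ⊔ Submodule.span ℚ {(Pi.single x₀ 1 : H → ℚ)} : Submodule ℚ (H → ℚ)) := by
        rw [htop, finrank_top, Module.finrank_fintype_fun_eq_card]
    _ ≤ Module.finrank ℚ S + Module.finrank ℚ (Submodule.span ℚ {(Pi.single x₀ 1 : H → ℚ)}) :=
        Submodule.finrank_add_le_finrank_add_finrank _ _
    _ ≤ Module.finrank ℚ S + 1 := by
        gcongr
        exact (finrank_span_le_card _).trans (by simp)

/-- If `σ` and `τ` generate a transitive group, functions invariant under `σ⁻¹ * τ` map to the
intersection of the ranges of `permDiff σ` and `permDiff τ` with only the constants as kernel. -/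
theorem numOrbits_inv_mul_le [Fintype H] {σ τ : Equiv.Perm H} (x₀ : H)
    (htrans : ∀ y : H, ∃ p ∈ Subgroup.closure ({σ, τ} : Set (Equiv.Perm H)), p x₀ = y) :
    numOrbits (σ⁻¹ * τ) ≤ Module.finrank ℚ
      (LinearMap.range (permDiff σ) ⊓ LinearMap.range (permDiff τ) : Submodule ℚ (H → ℚ)) + 1 := by
  set F := LinearMap.ker (permDiff (σ⁻¹ * τ)) with hF
  have heq : ∀ f ∈ F, permDiff σ f = permDiff τ f := by
    intro f hf
    ext h
    have := mem_ker_permDiff.mp hf (τ.symm h)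
    rw [Equiv.Perm.mul_apply, Equiv.apply_symm_apply, Equiv.Perm.inv_def] at this
    rw [permDiff_apply, permDiff_apply, this]
  set g := (permDiff σ).domRestrict F
  have hrange : LinearMap.range g ≤
      LinearMap.range (permDiff σ) ⊓ LinearMap.range (permDiff τ) := by
    rintro _ ⟨f, rfl⟩
    exact ⟨⟨f, rfl⟩, ⟨f, (heq f f.2).symm⟩⟩
  have hker : Module.finrank ℚ (LinearMap.ker g) ≤ 1 := by
    let ev : LinearMap.ker g →ₗ[ℚ] ℚ :=
      LinearMap.proj x₀ ∘ₗ F.subtype ∘ₗ (LinearMap.ker g).subtype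
    have hev : Function.Injective ev := by
      rw [injective_iff_map_eq_zero]
      rintro ⟨⟨f, hfF⟩, hfg⟩ hf0
      change f x₀ = 0 at hf0
      have hfσ : permDiff σ f = 0 := hfg
      have hfτ : permDiff τ f = 0 := (heq f hfF).symm.trans hfσ
      have hinv : ∀ p ∈ Subgroup.closure ({σ, τ} : Set (Equiv.Perm H)), ∀ x, f (p x) = f x := by
        intro p hp
        induction hp using Subgroup.closure_induction with
        | mem p hp =>
          rcases hp with rfl | rfl
          · exact mem_ker_permDiff.mp hfσ
          · exact mem_ker_permDiff.mp hfτ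
        | one => intro x; rfl
        | mul p q _ _ hp hq => intro x; rw [Equiv.Perm.mul_apply, hp, hq]
        | inv p _ hp => intro x; rw [Equiv.Perm.inv_def, ← hp (p.symm x), Equiv.apply_symm_apply]
      have hf : f = 0 := by
        ext y
        obtain ⟨p, hp, rfl⟩ := htrans y
        rw [hinv p hp, hf0, Pi.zero_apply]
      subst hf
      rfl
    simpa using LinearMap.finrank_le_finrank_of_injective hev
  rw [← finrank_ker_permDiff, ← hF, ← LinearMap.finrank_range_add_finrank_ker g]
  exact add_le_add (Submodule.finrank_mono hrange) hker

/-- The Riemann–Hurwitz inequality for a pair of permutations generating a transitive group. -/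
theorem numOrbits_add_le_card_add_two [Fintype H] (σ τ : Equiv.Perm H)
    (htrans : ∀ x y : H, ∃ p ∈ Subgroup.closure ({σ, τ} : Set (Equiv.Perm H)), p x = y) :
    numOrbits σ + numOrbits τ + numOrbits (σ⁻¹ * τ) ≤ Fintype.card H + 2 := by
  have hσ := finrank_range_permDiff σ
  have hτ := finrank_range_permDiff τ
  rcases isEmpty_or_nonempty H with hH | ⟨⟨x₀⟩⟩
  · have hρ := finrank_range_permDiff (σ⁻¹ * τ)
    have := Fintype.card_eq_zero_iff.mpr hH
    omega
  · have hsup := card_le_finrank_range_sup x₀ (htrans x₀)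
    have hinf := numOrbits_inv_mul_le x₀ (htrans x₀)
    have hdim := Submodule.finrank_sup_add_finrank_inf_eq
      (LinearMap.range (permDiff σ)) (LinearMap.range (permDiff τ))
    omega

/-- Every orbit of an involution has at most two elements. -/
theorem card_le_two_mul_numOrbits [Fintype H] {σ : Equiv.Perm H} (hinv : σ * σ = 1) :
    Fintype.card H ≤ 2 * numOrbits σ := by
  classical
  unfold numOrbits
  set s : Setoid H := ⟨σ.SameCycle, _⟩
  have : Fintype (Quotient s) := Fintype.ofFinite _
  rw [Nat.card_eq_fintype_card]
  refine Finset.card_le_mul_card_image_of_maps_to (s := Finset.univ) (t := Finset.univ)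
    (f := Quotient.mk s) (fun _ _ => Finset.mem_univ _) 2 fun q _ => ?_
  obtain ⟨x, rfl⟩ := Quotient.exists_rep q
  refine (Finset.card_le_card (t := {x, σ x}) fun y hy => ?_).trans Finset.card_le_two
  have hxy : σ.SameCycle x y := (Quotient.exact (Finset.mem_filter.mp hy).2).symm
  obtain ⟨i, rfl⟩ := hxy
  have hsq : σ ^ (2 : ℤ) = 1 := by rw [zpow_ofNat, pow_two, hinv]
  rw [Finset.mem_insert, Finset.mem_singleton]
  rcases Int.even_or_odd' i with ⟨k, rfl | rfl⟩
  · left; rw [zpow_mul, hsq, one_zpow, Equiv.Perm.one_apply]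
  · right; rw [zpow_add_one, zpow_mul, hsq, one_zpow, one_mul]

end RibbonGenus

/-- For a connected ribbon graph (the subgroup generated by `σ0` and `σ1` acts transitively
on the half-edges), with `v` vertices, `e` edges and `n` boundary cycles one has
`v - e + n ≤ 2`, i.e. the genus `g` with `v - e + n = 2 - 2g` satisfies `g ≥ 0`. -/
theorem stmt_1 {H : Type*} [Fintype H] (σ0 σ1 : Equiv.Perm H)
    (hinv : σ1 * σ1 = 1) (hfpf : ∀ h : H, σ1 h ≠ h)
    (htrans : ∀ x y : H, ∃ p ∈ Subgroup.closure ({σ0, σ1} : Set (Equiv.Perm H)), p x = y) :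
    (numOrbits σ0 : ℤ) - numOrbits σ1 + numOrbits (σ0⁻¹ * σ1) ≤ 2 := by
  have hRH := numOrbits_add_le_card_add_two σ0 σ1 htrans
  have hcard := card_le_two_mul_numOrbits hinv
  omega
end

section
/- Label the half-edges of the twisted theta graph by {1,2,3,4,5,6} and set σ0 = (1 2 3)(4 5 6) and σ1 = (1 4)(2 5)(3 6), so that σ∞ := σ0⁻¹σ1 is a single 6-cycle (one boundary cycle, genus one). Then: (a) the set C of permutations η of {1,2,3,4,5,6} with η σ0 = σ0 η and η σ1 = σ1 η is exactly the cyclic group generated by σ0σ1 and has order 6; (b) every element of C maps each of the three edges {1,4}, {2,5}, {3,6} onto an edge, and the set of induced permutations of these three edges is a cyclic group of order 3 (the cyclic rotations). Thus the ribbon graph automorphisms of the twisted theta graph act on its set of edges through the group ℤ/3ℤ. -/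
/-- `σ0` for the twisted theta graph: the two trivalent vertices `(1 2 3)(4 5 6)`
(half-edges relabeled `0,…,5`). -/
def twThetaSigma0 : Equiv.Perm (Fin 6) := c[0, 1, 2] * c[3, 4, 5]

/-- `σ1` for the twisted theta graph: the three edges `(1 4)(2 5)(3 6)`
(half-edges relabeled `0,…,5`). -/
def twThetaSigma1 : Equiv.Perm (Fin 6) := c[0, 3] * c[1, 4] * c[2, 5]

/-- The set of ribbon graph automorphisms of the twisted theta graph: permutations of the
half-edges commuting with both `σ0` and `σ1`. -/
def twThetaAut : Set (Equiv.Perm (Fin 6)) :=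
  {η | η * twThetaSigma0 = twThetaSigma0 * η ∧ η * twThetaSigma1 = twThetaSigma1 * η}

/-- The three edges `{1,4}, {2,5}, {3,6}` of the twisted theta graph
(relabeled `{0,3}, {1,4}, {2,5}`). -/
def twThetaEdges : Fin 3 → Finset (Fin 6) := ![{0, 3}, {1, 4}, {2, 5}]

/-- The permutations of the three edges induced by ribbon graph automorphisms. -/
def twThetaInduced : Set (Equiv.Perm (Fin 3)) :=
  {π | ∃ η ∈ twThetaAut, ∀ i : Fin 3, (twThetaEdges i).image η = twThetaEdges (π i)}

/-- A permutation commuting with a transitive permutation `ρ` is a power of `ρ`. -/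
theorem Equiv.Perm.mem_zpowers_of_commute_of_sameCycle {α : Type*} {ρ η : Equiv.Perm α} (a : α)
    (htrans : ∀ x, ρ.SameCycle a x) (h : Commute η ρ) : η ∈ Subgroup.zpowers ρ := by
  obtain ⟨k, hk⟩ := htrans (η a)
  refine ⟨k, Equiv.ext fun x => ?_⟩
  obtain ⟨j, rfl⟩ := htrans x
  have hη : η ((ρ ^ j) a) = (ρ ^ j) (η a) := congrArg (· a) (h.zpow_right j).eq
  have hρ : (ρ ^ k) ((ρ ^ j) a) = (ρ ^ j) ((ρ ^ k) a) :=
    congrArg (· a) (Commute.zpow_zpow_self ρ k j).eq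
  exact hρ.trans ((congrArg _ hk).trans hη.symm)

theorem twThetaSigma_commute : Commute twThetaSigma0 twThetaSigma1 := by
  unfold Commute SemiconjBy
  decide

theorem sameCycle_twThetaSigma0_mul_twThetaSigma1 (x : Fin 6) :
    (twThetaSigma0 * twThetaSigma1).SameCycle 0 x := by
  have h : ∀ x : Fin 6, ∃ k : Fin 6, ((twThetaSigma0 * twThetaSigma1) ^ (k : ℕ)) 0 = x := by
    decide
  obtain ⟨k, hk⟩ := h x
  exact ⟨(k : ℕ), by simpa only [zpow_natCast] using hk⟩

theorem twThetaAut_eq_zpowers :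
    twThetaAut = ↑(Subgroup.zpowers (twThetaSigma0 * twThetaSigma1)) := by
  ext η
  constructor
  · rintro ⟨h0, h1⟩
    exact Equiv.Perm.mem_zpowers_of_commute_of_sameCycle 0
      sameCycle_twThetaSigma0_mul_twThetaSigma1 (Commute.mul_right h0 h1)
  · rintro ⟨k, rfl⟩
    exact ⟨(((Commute.refl twThetaSigma0).mul_left twThetaSigma_commute.symm).zpow_left k).eq,
      ((twThetaSigma_commute.mul_left (Commute.refl twThetaSigma1)).zpow_left k).eq⟩

set_option maxRecDepth 4000 in
theorem orderOf_twThetaSigma0_mul_twThetaSigma1 :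
    orderOf (twThetaSigma0 * twThetaSigma1) = 6 := by
  rw [orderOf_eq_iff (by norm_num)]
  refine ⟨by decide, fun m hm hpos => ?_⟩
  interval_cases m <;> decide

theorem orderOf_finRotate_three : orderOf (finRotate 3) = 3 :=
  orderOf_eq_prime (by decide) (by decide)

theorem twThetaEdges_injective : Function.Injective twThetaEdges := by
  decide

theorem image_twThetaEdges_pow (n : ℕ) (i : Fin 3) :
    (twThetaEdges i).image ((twThetaSigma0 * twThetaSigma1) ^ n) =
      twThetaEdges ((finRotate 3 ^ n) i) := by
  induction n with
  | zero => simp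
  | succ n ih =>
    have h : ∀ j, (twThetaEdges j).image (twThetaSigma0 * twThetaSigma1) =
        twThetaEdges (finRotate 3 j) := by
      decide
    rw [pow_succ', pow_succ', Equiv.Perm.coe_mul, ← Finset.image_image, ih, h,
      Equiv.Perm.mul_apply]

theorem exists_pow_eq_of_mem_twThetaAut {η : Equiv.Perm (Fin 6)} (hη : η ∈ twThetaAut) :
    ∃ n : ℕ, (twThetaSigma0 * twThetaSigma1) ^ n = η := by
  rw [twThetaAut_eq_zpowers] at hη
  exact mem_powers_iff_mem_zpowers.mpr hη

theorem twThetaInduced_eq_zpowers :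
    twThetaInduced = ↑(Subgroup.zpowers (finRotate 3)) := by
  ext π
  constructor
  · rintro ⟨η, hη, hπ⟩
    obtain ⟨n, rfl⟩ := exists_pow_eq_of_mem_twThetaAut hη
    have h : finRotate 3 ^ n = π := Equiv.ext fun i =>
      twThetaEdges_injective ((image_twThetaEdges_pow n i).symm.trans (hπ i))
    exact h ▸ Subgroup.npow_mem_zpowers _ n
  · intro hπ
    obtain ⟨n, rfl⟩ := mem_powers_iff_mem_zpowers.mpr hπ
    refine ⟨(twThetaSigma0 * twThetaSigma1) ^ n, ?_, image_twThetaEdges_pow n⟩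
    rw [twThetaAut_eq_zpowers]
    exact Subgroup.npow_mem_zpowers _ n

/-- (a) The automorphisms of the twisted theta graph form the cyclic group generated by
`σ0 σ1`, of order 6; (b) each automorphism maps every edge onto an edge, and the induced
permutations of the three edges form the cyclic group of order 3 of cyclic rotations:
the automorphisms act on the edges through `ℤ/3ℤ`. -/
theorem stmt_5 :
    (twThetaAut = ↑(Subgroup.zpowers (twThetaSigma0 * twThetaSigma1)) ∧
      Nat.card twThetaAut = 6) ∧
    ((∀ η ∈ twThetaAut, ∀ i : Fin 3, ∃ j : Fin 3,
        (twThetaEdges i).image η = twThetaEdges j) ∧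
      twThetaInduced = ↑(Subgroup.zpowers (finRotate 3)) ∧
      Nat.card twThetaInduced = 3) := by
  refine ⟨⟨twThetaAut_eq_zpowers, ?_⟩, ?_, twThetaInduced_eq_zpowers, ?_⟩
  · rw [twThetaAut_eq_zpowers]
    exact (Nat.card_zpowers _).trans orderOf_twThetaSigma0_mul_twThetaSigma1
  · intro η hη i
    obtain ⟨n, rfl⟩ := exists_pow_eq_of_mem_twThetaAut hη
    exact ⟨_, image_twThetaEdges_pow n i⟩
  · rw [twThetaInduced_eq_zpowers]
    exact (Nat.card_zpowers _).trans orderOf_finRotate_three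
end

section
/- Let γ : ℝ → ℂ be differentiable with γ(t) ≠ 0 for all t, and suppose that for every t the complex number (deriv γ(t))²/(γ(t))² is a positive real number. Then γ stays on a fixed ray from the origin: for all s, t there exists a real number r > 0 with γ(s) = r · γ(t). That is, the vertical trajectories of the quadratic differential q = −dz²/z² are radial rays emanating from the double pole. -/
/-- A complex number whose square is a positive real number is real. -/
theorem Complex.im_eq_zero_of_sq_pos {w : ℂ} (him : (w ^ 2).im = 0) (hre : 0 < (w ^ 2).re) :
    w.im = 0 := by
  simp only [pow_two, Complex.mul_im, Complex.mul_re] at him hre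
  have hmul : w.re * w.im = 0 := by linarith
  rcases mul_eq_zero.mp hmul with h0 | h0
  · rw [h0] at hre
    nlinarith [mul_self_nonneg w.im]
  · exact h0

/-- If the velocity of a curve is a real multiple of its nonzero position, then the direction
of the position is stationary. -/
theorem hasDerivAt_inv_norm_smul_of_radial {E : Type*} [NormedAddCommGroup E]
    [InnerProductSpace ℝ E] {γ : ℝ → E} {c t : ℝ} (hγ : HasDerivAt γ (c • γ t) t)
    (hne : γ t ≠ 0) : HasDerivAt (fun x => ‖γ x‖⁻¹ • γ x) 0 t := by
  have hpos : ‖γ t‖ ≠ 0 := norm_ne_zero_iff.mpr hne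
  have hnorm : HasDerivAt (fun x => ‖γ x‖) (c * ‖γ t‖) t := by
    have hsqrt := hγ.norm_sq.sqrt (pow_ne_zero 2 hpos)
    simp only [Real.sqrt_sq (norm_nonneg _), inner_smul_right, real_inner_self_eq_norm_sq]
      at hsqrt
    convert hsqrt using 1
    field_simp
  convert (hnorm.fun_inv hpos).fun_smul hγ using 1
  rw [smul_smul, ← add_smul]
  have hcoeff : ‖γ t‖⁻¹ * c + -(c * ‖γ t‖) / ‖γ t‖ ^ 2 = 0 := by
    field_simp
    ring
  rw [hcoeff, zero_smul]

/-- Vertical trajectories of the quadratic differential `q = -dz²/z²` are radial rays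
emanating from the double pole: if `γ : ℝ → ℂ` is differentiable, never `0`, and
`(γ'(t))²/(γ(t))²` is a positive real number for every `t`, then `γ` stays on a fixed ray
from the origin. -/
theorem stmt_11 (γ : ℝ → ℂ) (hγ : Differentiable ℝ γ) (hne : ∀ t : ℝ, γ t ≠ 0)
    (h : ∀ t : ℝ, ((deriv γ t) ^ 2 / (γ t) ^ 2).im = 0 ∧
      0 < ((deriv γ t) ^ 2 / (γ t) ^ 2).re) :
    ∀ s t : ℝ, ∃ r : ℝ, 0 < r ∧ γ s = (r : ℂ) * γ t := by
  have hdir (t : ℝ) : HasDerivAt (fun x => ‖γ x‖⁻¹ • γ x) 0 t := by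
    obtain ⟨him, hre⟩ := h t
    rw [← div_pow] at him hre
    have hreal : ((deriv γ t / γ t).re : ℂ) = deriv γ t / γ t :=
      Complex.ext rfl (Complex.im_eq_zero_of_sq_pos him hre).symm
    refine hasDerivAt_inv_norm_smul_of_radial (c := (deriv γ t / γ t).re) ?_ (hne t)
    rw [Complex.real_smul, hreal, div_mul_cancel₀ _ (hne t)]
    exact (hγ t).hasDerivAt
  intro s t
  have hconst := is_const_of_deriv_eq_zero (fun x => (hdir x).differentiableAt)
    (fun x => (hdir x).deriv) s t
  have hs : 0 < ‖γ s‖ := norm_pos_iff.mpr (hne s)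
  have ht : 0 < ‖γ t‖ := norm_pos_iff.mpr (hne t)
  refine ⟨‖γ s‖ / ‖γ t‖, div_pos hs ht, ?_⟩
  rw [← Complex.real_smul, div_eq_mul_inv, mul_smul, ← hconst, smul_inv_smul₀ hs.ne']
end

section
/- Fix n ≥ 1 and let V = { x : Fin n → ℝ | there exists a permutation σ of Fin n with x(i) = σ(i) + 1 for all i } be the set of points whose coordinates are a permutation of (1, 2, …, n). Then the set of extreme points of the permutohedron P = convexHull ℝ V is exactly V. In particular the permutohedron on an n-element set has exactly n! vertices. -/
/-- The vertices of the permutohedron on `n` letters: points of `ℝⁿ` whose coordinates are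
a permutation of `(1, 2, …, n)`. -/
def permutohedronVertices (n : ℕ) : Set (Fin n → ℝ) :=
  {x | ∃ σ : Equiv.Perm (Fin n), ∀ i, x i = ((σ i : ℕ) : ℝ) + 1}

/-- A set of points lying on a common Euclidean sphere around the origin consists of extreme points
of its convex hull. -/
theorem subset_extremePoints_convexHull_of_sum_sq_eq {ι : Type*} [Fintype ι] {A : Set (ι → ℝ)}
    {c : ℝ} (hA : ∀ x ∈ A, ∑ i, x i ^ 2 = c) :
    A ⊆ Set.extremePoints ℝ (convexHull ℝ A) := by
  have key : ∀ (y z : ι → ℝ) (a b : ℝ), a + b = 1 →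
      ∑ i, (a • y + b • z) i ^ 2 + a * b * ∑ i, (y i - z i) ^ 2 =
        a * ∑ i, y i ^ 2 + b * ∑ i, z i ^ 2 := by
    intro y z a b hab
    obtain rfl : b = 1 - a := by linarith
    simp only [Finset.mul_sum, ← Finset.sum_add_distrib]
    refine Finset.sum_congr rfl fun i _ => ?_
    simp only [Pi.add_apply, Pi.smul_apply, smul_eq_mul]
    ring
  have hull : convexHull ℝ A ⊆ {x | ∑ i, x i ^ 2 ≤ c} := by
    refine convexHull_min (fun x hx => (hA x hx).le) fun y hy z hz a b ha hb hab => ?_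
    simp only [Set.mem_ofPred_eq] at hy hz ⊢
    have hsq : 0 ≤ ∑ i, (y i - z i) ^ 2 := Finset.sum_nonneg fun i _ => sq_nonneg _
    obtain rfl : b = 1 - a := by linarith
    nlinarith [key y z a (1 - a) hab, mul_nonneg (mul_nonneg ha hb) hsq,
      mul_le_mul_of_nonneg_left hy ha, mul_le_mul_of_nonneg_left hz hb]
  intro x hx
  refine mem_extremePoints_iff_left.2 ⟨subset_convexHull ℝ A hx, ?_⟩
  rintro y hy z hz ⟨a, b, ha, hb, hab, rfl⟩
  have hy' : ∑ i, y i ^ 2 ≤ c := hull hy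
  have hz' : ∑ i, z i ^ 2 ≤ c := hull hz
  have hprod : a * b * ∑ i, (y i - z i) ^ 2 ≤ 0 := by
    have h := key y z a b hab
    rw [hA _ hx] at h
    have hc : a * c + b * c = c := by rw [← add_mul, hab, one_mul]
    linarith [mul_le_mul_of_nonneg_left hy' ha.le, mul_le_mul_of_nonneg_left hz' hb.le]
  have hzero : ∑ i, (y i - z i) ^ 2 = 0 :=
    le_antisymm (nonpos_of_mul_nonpos_right hprod (mul_pos ha hb))
      (Finset.sum_nonneg fun i _ => sq_nonneg _)
  have hyz : y = z := by
    funext i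
    have h := (Finset.sum_eq_zero_iff_of_nonneg fun i _ => sq_nonneg (y i - z i)).1 hzero i
      (Finset.mem_univ i)
    exact sub_eq_zero.1 (pow_eq_zero_iff two_ne_zero |>.1 h)
  rw [← hyz, ← add_smul, hab, one_smul]

/-- There are `n!` points whose coordinates are a permutation of `(1, …, n)`. -/
theorem card_permutohedronVertices (n : ℕ) :
    Nat.card (permutohedronVertices n) = Nat.factorial n := by
  let f : Equiv.Perm (Fin n) → Fin n → ℝ := fun σ i => ((σ i : ℕ) : ℝ) + 1
  have hf : Function.Injective f := fun σ τ h => Equiv.ext fun i => Fin.ext <| by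
    simpa [f] using congrFun h i
  have hrange : permutohedronVertices n = Set.range f := by
    ext x
    simp only [permutohedronVertices, Set.mem_ofPred_eq, Set.mem_range, f, funext_iff, eq_comm]
  rw [hrange, Nat.card_range_of_injective hf, Nat.card_perm, Nat.card_fin]

/-- The set of extreme points of the permutohedron (the convex hull of the points whose
coordinates are a permutation of `(1, …, n)`) is exactly that set of permutation points;
in particular the permutohedron on an `n`-element set has exactly `n!` vertices. -/
theorem stmt_12 (n : ℕ) (hn : 1 ≤ n) :
    Set.extremePoints ℝ (convexHull ℝ (permutohedronVertices n)) = permutohedronVertices n ∧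
      Nat.card (permutohedronVertices n) = Nat.factorial n := by
  refine ⟨extremePoints_convexHull_subset.antisymm
    (subset_extremePoints_convexHull_of_sum_sq_eq (c := ∑ i : Fin n, (((i : ℕ) : ℝ) + 1) ^ 2) ?_),
    card_permutohedronVertices n⟩
  rintro x ⟨σ, hσ⟩
  simp only [hσ]
  exact Equiv.sum_comp σ fun i : Fin n => (((i : ℕ) : ℝ) + 1) ^ 2
end

section
/- Fix n ≥ 1 and let V = { x : Fin n → ℝ | there exists a permutation σ of Fin n with x(i) = σ(i) + 1 for all i }. Then convexHull ℝ V = { x : Fin n → ℝ | ∑_{i} x(i) = n(n+1)/2 and for every nonempty finite subset A of Fin n, ∑_{i ∈ A} x(i) ≥ |A|(|A|+1)/2 }. That is, the permutohedron is cut out by the total-sum hyperplane together with one linear inequality for each nonempty subset of coordinates. -/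
open Finset in
/-- Abel summation inequality: pairing an antitone sequence with a sequence whose partial sums
are nonnegative. -/
theorem Antitone.last_mul_sum_le_sum_mul {m : ℕ} {d z : Fin (m + 1) → ℝ} (hd : Antitone d)
    (hz : ∀ k, 0 ≤ ∑ i ∈ Iic k, z i) :
    d (Fin.last m) * ∑ i, z i ≤ ∑ i, d i * z i := by
  induction m with
  | zero => simp
  | succ m ih =>
    have hz' : ∀ k : Fin (m + 1), 0 ≤ ∑ i ∈ Iic k, z i.castSucc := fun k => by
      have h := hz k.castSucc
      rwa [← Fin.map_castSuccEmb_Iic, sum_map] at h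
    have hstep := ih (d := fun i => d i.castSucc) (z := fun i => z i.castSucc)
      (hd.comp_monotone Fin.strictMono_castSucc.monotone) hz'
    have hS : 0 ≤ ∑ i : Fin (m + 1), z i.castSucc := by
      have h := hz' (Fin.last m)
      rwa [← Fin.top_eq_last, Iic_top] at h
    have hlast := mul_le_mul_of_nonneg_right (hd (Fin.le_last (Fin.last m).castSucc)) hS
    rw [Fin.sum_univ_castSucc, Fin.sum_univ_castSucc (fun i => d i * z i), mul_add]
    linarith

theorem sum_range_cast_add_one (k : ℕ) :
    ∑ i ∈ Finset.range k, ((i : ℝ) + 1) = (k : ℝ) * (k + 1) / 2 := by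
  induction k with
  | zero => simp
  | succ k ih => rw [Finset.sum_range_succ, ih]; push_cast; ring

theorem card_mul_card_add_one_div_two_le_sum (s : Finset ℕ) :
    (s.card : ℝ) * (s.card + 1) / 2 ≤ ∑ i ∈ s, ((i : ℝ) + 1) := by
  induction s using Finset.induction_on_max with
  | empty => simp
  | insert a s ha ih =>
    have hnot : a ∉ s := fun h => (ha a h).false
    have hcard : (s.card : ℝ) ≤ a := by
      have h := Finset.card_le_card (fun i hi => Finset.mem_range.2 (ha i hi) : s ⊆ Finset.range a)
      rw [Finset.card_range] at h
      exact_mod_cast h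
    rw [Finset.card_insert_of_notMem hnot, Finset.sum_insert hnot]
    push_cast
    linarith

theorem Fin.sum_Iic_cast_add_one {n : ℕ} (k : Fin n) :
    ∑ i ∈ Finset.Iic k, (((i : ℕ) : ℝ) + 1) = ((k : ℕ) + 1 : ℝ) * ((k : ℕ) + 1 + 1) / 2 := by
  have h := sum_range_cast_add_one (k + 1)
  rw [Nat.range_succ_eq_Iic, ← Fin.map_valEmbedding_Iic, Finset.sum_map] at h
  push_cast at h
  exact h

theorem finite_permutohedronVertices (n : ℕ) : (permutohedronVertices n).Finite := by
  refine (Set.finite_range fun (σ : Equiv.Perm (Fin n)) (i : Fin n) =>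
    ((σ i : ℕ) : ℝ) + 1).subset ?_
  rintro x ⟨σ, hσ⟩
  exact ⟨σ, (funext hσ).symm⟩

theorem sum_eq_of_mem_permutohedronVertices {n : ℕ} {x : Fin n → ℝ}
    (hx : x ∈ permutohedronVertices n) : ∑ i, x i = (n : ℝ) * (n + 1) / 2 := by
  obtain ⟨σ, hσ⟩ := hx
  simp_rw [hσ]
  rw [Equiv.sum_comp σ (fun i : Fin n => ((i : ℕ) : ℝ) + 1),
    Fin.sum_univ_eq_sum_range (fun i => (i : ℝ) + 1), sum_range_cast_add_one]

theorem le_sum_of_mem_permutohedronVertices {n : ℕ} {x : Fin n → ℝ}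
    (hx : x ∈ permutohedronVertices n) (A : Finset (Fin n)) :
    (A.card : ℝ) * (A.card + 1) / 2 ≤ ∑ i ∈ A, x i := by
  obtain ⟨σ, hσ⟩ := hx
  simpa [hσ] using
    card_mul_card_add_one_div_two_le_sum (A.map (σ.toEmbedding.trans Fin.valEmbedding))

/-- A linear functional attains at some vertex a value at most its value at any point satisfying
the permutohedron inequalities. -/
theorem exists_mem_permutohedronVertices_sum_le {n : ℕ} (c : Fin n → ℝ) {x : Fin n → ℝ}
    (hsum : ∑ i, x i = (n : ℝ) * (n + 1) / 2)
    (hle : ∀ A : Finset (Fin n), A.Nonempty →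
      (A.card : ℝ) * (A.card + 1) / 2 ≤ ∑ i ∈ A, x i) :
    ∃ v ∈ permutohedronVertices n, ∑ i, c i * v i ≤ ∑ i, c i * x i := by
  set τ := Tuple.sort (fun i => -c i)
  have hanti : Antitone (c ∘ τ) := fun i j hij =>
    neg_le_neg_iff.1 (Tuple.monotone_sort (fun i => -c i) hij)
  set v : Fin n → ℝ := fun i => ((τ.symm i : ℕ) : ℝ) + 1
  have hv : v ∈ permutohedronVertices n := ⟨τ.symm, fun _ => rfl⟩
  refine ⟨v, hv, ?_⟩
  obtain _ | m := n
  · simp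
  have hpartial : ∀ k, 0 ≤ ∑ i ∈ Finset.Iic k, (x (τ i) - v (τ i)) := fun k => by
    have h := hle ((Finset.Iic k).map τ.toEmbedding) (by simp)
    rw [Finset.card_map, Finset.sum_map, Fin.card_Iic] at h
    have hsumv := Fin.sum_Iic_cast_add_one k
    rw [Finset.sum_sub_distrib]
    simp only [v, Equiv.symm_apply_apply]
    push_cast at h
    simp only [Equiv.coe_toEmbedding] at h
    linarith
  have habel := hanti.last_mul_sum_le_sum_mul hpartial
  have hzero : ∑ i, (x (τ i) - v (τ i)) = 0 := by
    rw [Equiv.sum_comp τ (fun i => x i - v i), Finset.sum_sub_distrib, hsum,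
      sum_eq_of_mem_permutohedronVertices hv, sub_self]
  rw [hzero, mul_zero] at habel
  simp only [Function.comp_apply] at habel
  rw [Equiv.sum_comp τ (fun i => c i * (x i - v i))] at habel
  simp_rw [mul_sub] at habel
  rw [Finset.sum_sub_distrib] at habel
  linarith

/-- The permutohedron is cut out by the total-sum hyperplane `∑ x i = n(n+1)/2` together
with the inequality `∑_{i ∈ A} x i ≥ |A|(|A|+1)/2` for each nonempty subset `A` of the
coordinates. -/
theorem stmt_13 (n : ℕ) (hn : 1 ≤ n) :
    convexHull ℝ (permutohedronVertices n) =
      {x : Fin n → ℝ | (∑ i, x i) = (n : ℝ) * (n + 1) / 2 ∧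
        ∀ A : Finset (Fin n), A.Nonempty →
          (A.card : ℝ) * (A.card + 1) / 2 ≤ ∑ i ∈ A, x i} := by
  apply Set.Subset.antisymm
  · refine convexHull_min (fun x hx => ⟨sum_eq_of_mem_permutohedronVertices hx,
      fun A _ => le_sum_of_mem_permutohedronVertices hx A⟩) ?_
    have hlin : ∀ A : Finset (Fin n), IsLinearMap ℝ fun x : Fin n → ℝ => ∑ i ∈ A, x i :=
      fun A => ⟨fun x y => by simp [Finset.sum_add_distrib], fun a x => by simp [Finset.mul_sum]⟩
    simp only [Set.ofPred_and, Set.ofPred_forall]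
    exact (convex_hyperplane (hlin Finset.univ) _).inter
      (convex_iInter₂ fun A _ => convex_halfSpace_ge (hlin A) _)
  · rintro x ⟨hsum, hle⟩
    by_contra hx
    obtain ⟨f, u, hfx, hf⟩ := geometric_hahn_banach_point_closed (convex_convexHull ℝ _)
      ((finite_permutohedronVertices n).isClosed_convexHull ℝ) hx
    obtain ⟨v, hv, hvx⟩ :=
      exists_mem_permutohedronVertices_sum_le (fun i => f (Pi.single i 1)) hsum hle
    have hcoord : ∀ y : Fin n → ℝ, f y = ∑ i, f (Pi.single i 1) * y i := fun y => by
      conv_lhs => rw [pi_eq_sum_univ' y]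
      simp [mul_comm, Pi.single]
    have hfv := hf v (subset_convexHull ℝ _ hv)
    rw [hcoord] at hfx hfv
    linarith
end

section
/- Fix n ≥ 1 and let V = { x : Fin n → ℝ | there exists a permutation σ of Fin n with x(i) = σ(i) + 1 for all i }, and P = convexHull ℝ V the permutohedron. Let T be a finite subset of Fin n with T nonempty and T ≠ Fin n, and let k = |T|. Then the face of P on which the inequality ∑_{i ∈ T} x(i) ≥ k(k+1)/2 is tight satisfies: { x ∈ P | ∑_{i ∈ T} x(i) = k(k+1)/2 } = convexHull ℝ { x ∈ V | x(i) ≤ k for all i ∈ T }, i.e., it is the convex hull of exactly those permutation points sending T onto {1, …, k}. (This face is the product of a permutohedron on T with a permutohedron on the complement of T, corresponding to the sequence S ⊃ Tᶜ of subsets.) -/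
/-- If a linear functional `f` is at least `c` on `s`, then the face of the convex hull of `s` on
which `f = c` is the convex hull of the points of `s` with `f = c`. -/
theorem convexHull_sep_eq_of_forall_le {E : Type*} [AddCommGroup E] [Module ℝ E]
    (s : Set E) (f : E →ₗ[ℝ] ℝ) (c : ℝ) (hc : ∀ x ∈ s, c ≤ f x) :
    {x ∈ convexHull ℝ s | f x = c} = convexHull ℝ {x ∈ s | f x = c} := by
  apply Set.Subset.antisymm
  · rintro x ⟨hx, hxc⟩
    have hsub : convexHull ℝ s ⊆
        {x | c ≤ f x ∧ (f x = c → x ∈ convexHull ℝ {x ∈ s | f x = c})} := by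
      refine convexHull_min (fun y hy => ⟨hc y hy, fun h => subset_convexHull ℝ _ ⟨hy, h⟩⟩) ?_
      rw [convex_iff_forall_pos]
      rintro y ⟨hy, hy'⟩ z ⟨hz, hz'⟩ a b ha hb hab
      have hf : f (a • y + b • z) - c = a * (f y - c) + b * (f z - c) := by
        simp only [map_add, map_smul, smul_eq_mul]
        linear_combination c * hab
      have h1 : 0 ≤ a * (f y - c) := mul_nonneg ha.le (sub_nonneg.2 hy)
      have h2 : 0 ≤ b * (f z - c) := mul_nonneg hb.le (sub_nonneg.2 hz)
      refine ⟨by linarith, fun h => ?_⟩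
      have h3 : a * (f y - c) = 0 := by linarith
      have h4 : b * (f z - c) = 0 := by linarith
      have h5 : f y = c := sub_eq_zero.1 ((mul_eq_zero.1 h3).resolve_left ha.ne')
      have h6 : f z = c := sub_eq_zero.1 ((mul_eq_zero.1 h4).resolve_left hb.ne')
      exact convex_convexHull ℝ _ (hy' h5) (hz' h6) ha.le hb.le hab
    exact (hsub hx).2 hxc
  · refine convexHull_min (fun y hy => ⟨subset_convexHull ℝ _ hy.1, hy.2⟩) ?_
    exact (convex_convexHull ℝ s).inter (convex_hyperplane f.isLinear c)

/-- The sum of a finite set of naturals exceeds the sum of an initial segment of the same size by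
at least the number of its elements outside that segment. -/
theorem sum_range_card_add_card_sdiff_le (A : Finset ℕ) :
    ∑ i ∈ Finset.range A.card, i + (A \ Finset.range A.card).card ≤ ∑ i ∈ A, i := by
  set R := Finset.range A.card with hR
  have hcard : (A \ R).card = (R \ A).card := Finset.card_sdiff_comm (by simp [hR])
  have h1 := Finset.sum_inter_add_sum_sdiff A R (fun i => i)
  have h2 := Finset.sum_inter_add_sum_sdiff R A (fun i => i)
  rw [Finset.inter_comm] at h2
  have h3 : (A \ R).card * A.card ≤ ∑ i ∈ A \ R, i := by
    rw [← smul_eq_mul]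
    refine Finset.card_nsmul_le_sum _ _ _ fun i hi => ?_
    simpa [hR] using (Finset.mem_sdiff.1 hi).2
  have h4 : ∑ i ∈ R \ A, (i + 1) ≤ (R \ A).card * A.card := by
    rw [← smul_eq_mul]
    refine Finset.sum_le_card_nsmul _ _ _ fun i hi => ?_
    simpa [hR] using (Finset.mem_sdiff.1 hi).1
  rw [Finset.sum_add_distrib, Finset.sum_const, smul_eq_mul, mul_one, ← hcard] at h4
  omega

theorem sum_range_card_le_sum (A : Finset ℕ) : ∑ i ∈ Finset.range A.card, i ≤ ∑ i ∈ A, i :=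
  (Nat.le_add_right _ _).trans (sum_range_card_add_card_sdiff_le A)

theorem sum_eq_sum_range_card_iff (A : Finset ℕ) :
    ∑ i ∈ A, i = ∑ i ∈ Finset.range A.card, i ↔ ∀ i ∈ A, i < A.card := by
  constructor
  · intro h
    have h0 : (A \ Finset.range A.card).card = 0 := by
      have := sum_range_card_add_card_sdiff_le A
      omega
    intro i hi
    exact Finset.mem_range.1 (Finset.sdiff_eq_empty_iff_subset.1 (Finset.card_eq_zero.1 h0) hi)
  · intro h
    have hA : A = Finset.range A.card :=
      Finset.eq_of_subset_of_card_le (fun i hi => Finset.mem_range.2 (h i hi)) (by simp)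
    exact congrArg (fun B : Finset ℕ => ∑ i ∈ B, i) hA

theorem sum_range_cast_add (k : ℕ) :
    ((∑ i ∈ Finset.range k, i : ℕ) : ℝ) + k = (k : ℝ) * (k + 1) / 2 := by
  induction k with
  | zero => simp
  | succ k ih =>
    rw [Finset.sum_range_succ]
    push_cast at ih ⊢
    linarith

/-- The facet inequality holds at the vertices, with equality exactly at the vertices whose
coordinates in `T` are at most `|T|`. -/
theorem le_sum_and_sum_eq_iff_of_mem_permutohedronVertices {n : ℕ} (T : Finset (Fin n))
    {x : Fin n → ℝ} (hx : x ∈ permutohedronVertices n) :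
    (T.card : ℝ) * (T.card + 1) / 2 ≤ ∑ i ∈ T, x i ∧
      (∑ i ∈ T, x i = (T.card : ℝ) * (T.card + 1) / 2 ↔ ∀ i ∈ T, x i ≤ (T.card : ℝ)) := by
  obtain ⟨σ, hσ⟩ := hx
  have hinj : Function.Injective fun i => (σ i : ℕ) :=
    Fin.val_injective.comp σ.injective
  set A := T.image fun i => (σ i : ℕ) with hA
  have hcard : A.card = T.card := Finset.card_image_of_injective _ hinj
  have hsum : ∑ i ∈ T, x i = ((∑ a ∈ A, a : ℕ) : ℝ) + T.card := by
    rw [hA, Finset.sum_image fun i _ j _ h => hinj h]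
    simp [hσ, Finset.sum_add_distrib]
  rw [hsum, ← sum_range_cast_add, ← hcard]
  refine ⟨add_le_add_left (Nat.cast_le.2 (sum_range_card_le_sum A)) _, ?_⟩
  rw [add_left_inj, Nat.cast_inj, sum_eq_sum_range_card_iff]
  simp only [hA, Finset.forall_mem_image, hσ]
  refine forall₂_congr fun i _ => ?_
  norm_cast

/-- For a proper nonempty subset `T` of the coordinates with `k = |T|`, the face of the
permutohedron where the facet inequality `∑_{i ∈ T} x i ≥ k(k+1)/2` is tight is the convex
hull of exactly those permutation points sending `T` onto `{1, …, k}` (this face is a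
product of the permutohedra on `T` and on its complement). -/
theorem stmt_14 (n : ℕ) (hn : 1 ≤ n) (T : Finset (Fin n)) (hT : T.Nonempty)
    (hTne : T ≠ Finset.univ) :
    {x ∈ convexHull ℝ (permutohedronVertices n) |
        ∑ i ∈ T, x i = (T.card : ℝ) * (T.card + 1) / 2} =
      convexHull ℝ {x ∈ permutohedronVertices n | ∀ i ∈ T, x i ≤ (T.card : ℝ)} := by
  have key := convexHull_sep_eq_of_forall_le (permutohedronVertices n)
    (∑ i ∈ T, LinearMap.proj i : (Fin n → ℝ) →ₗ[ℝ] ℝ) ((T.card : ℝ) * (T.card + 1) / 2)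
    fun x hx => by
      simpa using (le_sum_and_sum_eq_iff_of_mem_permutohedronVertices T hx).1
  simp only [LinearMap.sum_apply, LinearMap.proj_apply] at key
  rw [key]
  congr 1
  ext x
  exact and_congr_right fun hx => (le_sum_and_sum_eq_iff_of_mem_permutohedronVertices T hx).2
end
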